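/- Let n ≥ 3, let A ≤ Fₙ be the subgroup generated by a₁,…,a_{n−1}, set K₀ = K ⊓ A, G₀ = q(A) ≤ G, and V₀ := ℚ ⊗[ℤ] Additive (Abelianization K₀). Then there exists a representation ρ₀ : G₀ →* (V₀ ≃ₗ[ℚ] V₀) such that ρ₀(q(w)) [k] = [w k w⁻¹] for every w ∈ A and k ∈ K₀, and such that V₀, as a module over MonoidAlgebra ℚ G₀ via ρ₀, is isomorphic to (Fin (n−2) → MonoidAlgebra ℚ G₀) × ℚ, i.e. to ℚ[G₀]^{n−2} ⊕ ℚ. -/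

import Mathlib

open TensorProduct

/-- The representation (in the sense of `Representation`) associated to a homomorphism
into the group of `ℚ`-linear automorphisms. -/
def repOfAut {G V : Type*} [Group G] [AddCommGroup V] [Module ℚ V]
    (ρ : G →* (V ≃ₗ[ℚ] V)) : Representation ℚ G V where
  toFun g := (ρ g).toLinearMap
  map_one' := by ext v; simp
  map_mul' g h := by ext v; simp

lemma cw_quot_equiv {R X S : Type*} [Ring R] [IsSemisimpleRing R] [AddCommGroup X] [Module R X]
    [AddCommGroup S] [Module R S] [IsSimpleModule R S] (f g : S →ₗ[R] X)
    (hf : Function.Injective f) (hg : Function.Injective g) :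
    Nonempty ((X ⧸ LinearMap.range f) ≃ₗ[R] (X ⧸ LinearMap.range g)) := by
  have sf : IsAtom (LinearMap.range f) := by
    rw [← isSimpleModule_iff_isAtom]
    exact IsSimpleModule.congr (LinearEquiv.ofInjective f hf).symm
  have sg : IsAtom (LinearMap.range g) := by
    rw [← isSimpleModule_iff_isAtom]
    exact IsSimpleModule.congr (LinearEquiv.ofInjective g hg).symm
  by_cases h : LinearMap.range f = LinearMap.range g
  · rw [h]; exact ⟨LinearEquiv.refl _ _⟩
  have hd : Disjoint (LinearMap.range f) (LinearMap.range g) := sf.disjoint_of_ne sg h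
  have hd' := Submodule.disjoint_def.1 hd
  obtain ⟨P, hP⟩ := exists_isCompl (LinearMap.range f ⊔ LinearMap.range g)
  set D := LinearMap.range (f + g) with hD
  have key : ∀ F : Submodule R X, Disjoint F D → F ⊔ D = LinearMap.range f ⊔ LinearMap.range g →
      IsCompl F (D ⊔ P) := by
    intro F h1 h2
    rw [← h2] at hP
    refine ⟨h1.disjoint_sup_right_of_disjoint_sup_left hP.disjoint, ?_⟩
    rw [codisjoint_iff, ← sup_assoc]
    exact hP.sup_eq_top
  have k1 : IsCompl (LinearMap.range f) (D ⊔ P) := by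
    apply key
    · rw [Submodule.disjoint_def]
      rintro _ ⟨a, rfl⟩ ⟨b, hb⟩
      have h0 : g b = 0 := by
        apply hd' _ _ ⟨b, rfl⟩
        refine ⟨a - b, ?_⟩
        rw [map_sub, ← hb]; simp
      have : b = 0 := hg (by simpa using h0)
      subst this
      simpa using hb.symm
    · apply le_antisymm
      · apply sup_le le_sup_left
        rintro _ ⟨a, rfl⟩
        exact Submodule.add_mem_sup ⟨a, rfl⟩ ⟨a, rfl⟩
      · apply sup_le le_sup_left
        rintro _ ⟨a, rfl⟩
        have : g a = f (-a) + (f + g) a := by simp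
        rw [this]
        exact Submodule.add_mem_sup ⟨-a, rfl⟩ ⟨a, rfl⟩
  have k2 : IsCompl (LinearMap.range g) (D ⊔ P) := by
    apply key
    · rw [Submodule.disjoint_def]
      rintro _ ⟨a, rfl⟩ ⟨b, hb⟩
      have h0 : f b = 0 := by
        refine hd' _ ⟨b, rfl⟩ ⟨a - b, ?_⟩
        rw [map_sub, ← hb]; simp
      have : b = 0 := hf (by simpa using h0)
      subst this
      simpa using hb.symm
    · apply le_antisymm
      · apply sup_le le_sup_right
        rintro _ ⟨a, rfl⟩
        exact Submodule.add_mem_sup ⟨a, rfl⟩ ⟨a, rfl⟩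
      · refine sup_le ?_ le_sup_left
        rintro _ ⟨a, rfl⟩
        have : f a = g (-a) + (f + g) a := by simp
        rw [this]
        exact Submodule.add_mem_sup ⟨-a, rfl⟩ ⟨a, rfl⟩
  exact ⟨(Submodule.quotientEquivOfIsCompl _ _ k1).trans
    (Submodule.quotientEquivOfIsCompl _ _ k2).symm⟩

lemma cw_cancel_simple {R S M N : Type*} [Ring R] [IsSemisimpleRing R]
    [AddCommGroup S] [Module R S] [IsSimpleModule R S]
    [AddCommGroup M] [Module R M] [AddCommGroup N] [Module R N]
    (e : (S × M) ≃ₗ[R] (S × N)) : Nonempty (M ≃ₗ[R] N) := by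
  obtain ⟨k⟩ := cw_quot_equiv (LinearMap.inl R S N) (e.toLinearMap ∘ₗ LinearMap.inl R S M)
    LinearMap.inl_injective (e.injective.comp LinearMap.inl_injective)
  have h1 : ((S × N) ⧸ LinearMap.range (LinearMap.inl R S N)) ≃ₗ[R] N :=
    (Submodule.quotEquivOfEq _ _ (LinearMap.range_inl R S N)).trans
      (LinearMap.quotKerEquivOfSurjective _ LinearMap.snd_surjective)
  have h2 : ((S × M) ⧸ LinearMap.range (LinearMap.inl R S M)) ≃ₗ[R] M :=
    (Submodule.quotEquivOfEq _ _ (LinearMap.range_inl R S M)).trans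
      (LinearMap.quotKerEquivOfSurjective _ LinearMap.snd_surjective)
  have h3 : ((S × M) ⧸ LinearMap.range (LinearMap.inl R S M)) ≃ₗ[R]
      ((S × N) ⧸ LinearMap.range (e.toLinearMap ∘ₗ LinearMap.inl R S M)) :=
    Submodule.Quotient.equiv _ _ e (by rw [LinearMap.range_comp])
  exact ⟨h2.symm.trans (h3.trans (k.symm.trans h1))⟩

lemma cw_cancel {R Z M N : Type*} [Ring R] [IsSemisimpleRing R]
    [AddCommGroup Z] [Module R Z] [IsArtinian R Z]
    [AddCommGroup M] [Module R M] [AddCommGroup N] [Module R N] (C : Submodule R Z)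
    (e : (C × M) ≃ₗ[R] (C × N)) : Nonempty (M ≃ₗ[R] N) := by
  induction C using WellFoundedLT.induction with
  | ind C ih =>
  rcases IsSemisimpleModule.eq_bot_or_exists_simple_le C with rfl | ⟨S, hS, hs⟩
  · exact ⟨LinearEquiv.prodUnique.symm.trans <| (LinearEquiv.prodComm R _ _).trans <|
      e.trans <| (LinearEquiv.prodComm R _ _).trans LinearEquiv.prodUnique⟩
  · obtain ⟨T, hT⟩ := exists_isCompl S
    set C' := T ⊓ C
    have hsup : S ⊔ C' = C := by
      rw [← sup_inf_assoc_of_le _ hS, hT.sup_eq_top, top_inf_eq]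
    have hdis : Disjoint S C' := hT.disjoint.mono_right inf_le_left
    have hlt : C' < C := by
      refine lt_of_le_of_ne inf_le_right fun h => ?_
      have : S ≤ C' := h ▸ hS
      have h0 : S = ⊥ := by simpa using hdis.le_bot.trans' (le_inf le_rfl this)
      exact (isSimpleModule_iff_isAtom.1 hs).1 h0
    have d : (S × C') ≃ₗ[R] C := by
      refine LinearEquiv.ofBijective ((Submodule.inclusion hS).coprod
        (Submodule.inclusion inf_le_right)) ⟨?_, ?_⟩
      · rw [injective_iff_map_eq_zero]
        rintro ⟨a, b⟩ h
        have h' : (a : Z) + b = 0 := congrArg Subtype.val h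
        have ha : (a : Z) = 0 := Submodule.disjoint_def.1 hdis _ a.2 (by
          rw [eq_neg_of_add_eq_zero_left h']; exact neg_mem b.2)
        have hb : (b : Z) = 0 := by simpa [ha] using h'
        ext <;> simp [ha, hb]
      · rintro ⟨c, hc⟩
        rw [← hsup] at hc
        obtain ⟨a, ha, b, hb, rfl⟩ := Submodule.mem_sup.1 hc
        exact ⟨(⟨a, ha⟩, ⟨b, hb⟩), rfl⟩
    obtain ⟨k⟩ := cw_cancel_simple (S := S) (M := C' × M) (N := C' × N)
      ((LinearEquiv.prodAssoc R _ _ _).symm.trans <| (d.prodCongr (LinearEquiv.refl R M)).trans <|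
        e.trans <| (d.symm.prodCongr (LinearEquiv.refl R N)).trans (LinearEquiv.prodAssoc R _ _ _))
    exact ih C' hlt k

lemma cw_split {R M N : Type*} [Ring R] [IsSemisimpleRing R]
    [AddCommGroup M] [Module R M] [AddCommGroup N] [Module R N] (f : M →ₗ[R] N) :
    Nonempty (M ≃ₗ[R] (LinearMap.range f × LinearMap.ker f)) := by
  obtain ⟨P, hP⟩ := exists_isCompl (LinearMap.ker f)
  exact ⟨(Submodule.prodEquivOfIsCompl _ _ hP).symm.trans <|
    (LinearEquiv.prodComm R _ _).trans <|
    ((Submodule.quotientEquivOfIsCompl _ _ hP).symm.trans f.quotKerEquivRange).prodCongr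
      (LinearEquiv.refl R _)⟩

/-- the algebraic core -/
lemma cw_alg {R T : Type*} [Ring R] [IsSemisimpleRing R] [AddCommGroup T] [Module R T] (m : ℕ)
    (f : (Fin (m + 1) → R) →ₗ[R] R) (ε : R →ₗ[R] T) (hε : Function.Surjective ε)
    (h : LinearMap.range f = LinearMap.ker ε) :
    Nonempty (LinearMap.ker f ≃ₗ[R] ((Fin m → R) × T)) := by
  obtain ⟨a⟩ := cw_split f
  obtain ⟨b⟩ := cw_split ε
  have b' : R ≃ₗ[R] (T × LinearMap.range f) := b.trans
    ((LinearEquiv.ofTop _ (LinearMap.range_eq_top.2 hε)).prodCongr (LinearEquiv.ofEq _ _ h.symm))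
  apply cw_cancel (LinearMap.range f)
  refine a.symm.trans <| (Fin.consLinearEquiv R (fun _ : Fin (m + 1) => R)).symm.trans <| (LinearEquiv.prodComm R _ _).trans <|
    ((LinearEquiv.refl R _).prodCongr b').trans <| (LinearEquiv.prodAssoc R _ _ _).symm.trans
    (LinearEquiv.prodComm R _ _)

section CW
set_option linter.unusedSectionVars false
variable {X G : Type} [Fintype X] [DecidableEq X] [Group G]

/-- left translation by a group element on `ℚ[G]^X` followed by adding a vector -/
noncomputable def cwAff (g : G) (u : X → MonoidAlgebra ℚ G) :
    Equiv.Perm (X → MonoidAlgebra ℚ G) where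
  toFun v := MonoidAlgebra.of ℚ G g • v + u
  invFun v := MonoidAlgebra.of ℚ G g⁻¹ • (v - u)
  left_inv v := by
    beta_reduce
    rw [add_sub_cancel_right, smul_smul, ← map_mul, inv_mul_cancel, map_one, one_smul]
  right_inv v := by
    beta_reduce
    rw [smul_smul, ← map_mul, mul_inv_cancel, map_one, one_smul, sub_add_cancel]

lemma cwAff_apply (g : G) (u v : X → MonoidAlgebra ℚ G) :
    cwAff g u v = MonoidAlgebra.of ℚ G g • v + u := rfl

/-- the affine action of the free group given by the Fox derivative -/
noncomputable def cwLift (p : FreeGroup X →* G) :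
    FreeGroup X →* Equiv.Perm (X → MonoidAlgebra ℚ G) :=
  FreeGroup.lift fun x => cwAff (p (FreeGroup.of x)) (Pi.single x 1)

/-- the Fox derivative -/
noncomputable def cwD (p : FreeGroup X →* G) (w : FreeGroup X) : X → MonoidAlgebra ℚ G :=
  cwLift p w 0

lemma cwLift_apply (p : FreeGroup X →* G) (w : FreeGroup X) :
    ∀ v, cwLift p w v = MonoidAlgebra.of ℚ G (p w) • v + cwD p w := by
  induction w using FreeGroup.induction_on with
  | C1 => intro v; simp only [cwD, map_one, one_smul, Equiv.Perm.one_apply, add_zero]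
  | of x => intro v; simp only [cwD, cwLift, FreeGroup.lift_apply_of, cwAff_apply, smul_zero, zero_add]
  | inv_of x ih =>
    intro v
    have h : ∀ v, cwLift p (FreeGroup.of x)⁻¹ v =
        MonoidAlgebra.of ℚ G (p (FreeGroup.of x))⁻¹ • (v - Pi.single x 1) := by
      intro v
      rw [map_inv, cwLift, FreeGroup.lift_apply_of]; rfl
    rw [cwD, h, h, map_inv p, ← smul_add, zero_sub, sub_eq_add_neg]
  | mul a b iha ihb =>
    intro v
    rw [cwD, map_mul, Equiv.Perm.mul_apply, Equiv.Perm.mul_apply, iha, iha, ihb, ihb 0, map_mul,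
      map_mul, smul_zero, zero_add, smul_add, smul_smul, add_assoc]

lemma cwD_mul (p : FreeGroup X →* G) (a b : FreeGroup X) :
    cwD p (a * b) = cwD p a + MonoidAlgebra.of ℚ G (p a) • cwD p b := by
  rw [cwD, map_mul, Equiv.Perm.mul_apply, cwLift_apply p a, add_comm]; rfl

lemma cwD_one (p : FreeGroup X →* G) : cwD p 1 = 0 := by
  simp [cwD]

lemma cwD_of (p : FreeGroup X →* G) (x : X) : cwD p (FreeGroup.of x) = Pi.single x 1 := by
  simp only [cwD, cwLift, FreeGroup.lift_apply_of, cwAff_apply, smul_zero, zero_add]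

lemma cwD_mul_inv (p : FreeGroup X →* G) (a b : FreeGroup X) (h : p a = p b) :
    cwD p (a * b⁻¹) = cwD p a - cwD p b := by
  have h1 := cwD_mul p (a * b⁻¹) b
  rw [inv_mul_cancel_right, map_mul, map_inv, h, mul_inv_cancel, map_one, one_smul] at h1
  rw [h1, add_sub_cancel_right]

/-- the boundary map -/
noncomputable def cwBd (p : FreeGroup X →* G) :
    (X → MonoidAlgebra ℚ G) →ₗ[MonoidAlgebra ℚ G] MonoidAlgebra ℚ G :=
  ∑ x, (LinearMap.toSpanSingleton (MonoidAlgebra ℚ G) _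
    (MonoidAlgebra.of ℚ G (p (FreeGroup.of x)) - 1)) ∘ₗ LinearMap.proj x

lemma cwBd_single (p : FreeGroup X →* G) (x : X) (r : MonoidAlgebra ℚ G) :
    cwBd p (Pi.single x r) = r * (MonoidAlgebra.of ℚ G (p (FreeGroup.of x)) - 1) := by
  rw [cwBd, LinearMap.sum_apply, Finset.sum_eq_single x]
  · simp
  · intro b _ hb
    simp [Pi.single_eq_of_ne hb]
  · simp

lemma cwBd_D (p : FreeGroup X →* G) (w : FreeGroup X) :
    cwBd p (cwD p w) = MonoidAlgebra.of ℚ G (p w) - 1 := by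
  induction w using FreeGroup.induction_on with
  | C1 => rw [cwD_one, map_zero, map_one, map_one, sub_self]
  | of x => rw [cwD_of, cwBd_single, one_mul]
  | inv_of x ih =>
    have h1 := cwD_mul p (FreeGroup.of x)⁻¹ (FreeGroup.of x)
    rw [inv_mul_cancel, cwD_one] at h1
    rw [eq_neg_of_add_eq_zero_left h1.symm, map_neg, map_smul, ih, smul_sub, smul_eq_mul, ← map_mul,
      ← map_mul, inv_mul_cancel, map_one, map_one, smul_eq_mul, mul_one, neg_sub]
  | mul a b iha ihb =>
    rw [cwD_mul, map_add, map_smul, iha, ihb, map_mul, map_mul, smul_eq_mul, mul_sub, mul_one]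
    abel

variable {K : Type} [Group K]

/-- The class `[k]`. -/
noncomputable def cwCl (k : K) : ℚ ⊗[ℤ] Additive (Abelianization K) :=
  (1 : ℚ) ⊗ₜ[ℤ] Additive.ofMul (Abelianization.of k)

lemma cwCl_mul (a b : K) : cwCl (a * b) = cwCl a + cwCl b := by
  rw [cwCl, map_mul, ofMul_mul, TensorProduct.tmul_add]; rfl

/-- linear maps out of `V` -/
lemma cw_exists_lift {W : Type} [AddCommGroup W] [Module ℚ W] (φ : K → W)
    (h : ∀ a b, φ (a * b) = φ a + φ b) :
    ∃ f : (ℚ ⊗[ℤ] Additive (Abelianization K)) →ₗ[ℚ] W, ∀ k, f (cwCl k) = φ k := by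
  let φ' : K →* Multiplicative W := MonoidHom.mk' (fun k => Multiplicative.ofAdd (φ k)) (by
    intro a b; rw [h, ofAdd_add])
  let g : Additive (Abelianization K) →+ W := MonoidHom.toAdditiveLeft (Abelianization.lift φ')
  refine ⟨LinearMap.liftBaseChange ℚ g.toIntLinearMap, fun k => ?_⟩
  rw [cwCl, LinearMap.liftBaseChange_tmul, one_smul]
  rfl

lemma cw_hom_ext {W : Type} [AddCommGroup W] [Module ℚ W]
    {f g : (ℚ ⊗[ℤ] Additive (Abelianization K)) →ₗ[ℚ] W}
    (h : ∀ k, f (cwCl k) = g (cwCl k)) : f = g := by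
  apply LinearMap.ext
  intro v
  induction v using TensorProduct.induction_on with
  | zero => simp
  | add a b ha hb => rw [map_add, map_add, ha, hb]
  | tmul r y =>
    obtain ⟨k, hk⟩ := QuotientGroup.mk_surjective (Additive.toMul y)
    have : r ⊗ₜ[ℤ] y = r • cwCl k := by
      rw [cwCl, TensorProduct.smul_tmul', smul_eq_mul, mul_one]
      congr 1
      exact hk.symm
    rw [this, map_smul, map_smul, h]

/-- additive extensionality on `ℚ[G]^X` -/
lemma cw_pi_ext {W : Type} [AddCommGroup W] [Module ℚ W]
    {f g : (X → MonoidAlgebra ℚ G) →ₗ[ℚ] W}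
    (h : ∀ x a, f (Pi.single x (MonoidAlgebra.of ℚ G a)) = g (Pi.single x (MonoidAlgebra.of ℚ G a))) :
    f = g := by
  apply LinearMap.pi_ext
  intro x r
  induction r using MonoidAlgebra.induction_on with
  | of a => exact h x a
  | add a b ha hb => rw [Pi.single_add, map_add, map_add, ha, hb]
  | smul c a ha => rw [Pi.single_smul, map_smul, map_smul, ha]

/-- linear maps out of `ℚ[G]` -/
lemma cw_exists_alg {W : Type} [AddCommGroup W] [Module ℚ W] (φ : G → W) :
    ∃ f : MonoidAlgebra ℚ G →ₗ[ℚ] W, ∀ g, f (MonoidAlgebra.of ℚ G g) = φ g := by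
  let e : MonoidAlgebra ℚ G →ₗ[ℚ] (G →₀ ℚ) :=
    { toFun := fun r => r.coeff
      map_add' := fun _ _ => rfl
      map_smul' := fun _ _ => rfl }
  refine ⟨Finsupp.linearCombination ℚ φ ∘ₗ e, fun g => ?_⟩
  have : e (MonoidAlgebra.of ℚ G g) = Finsupp.single g 1 := rfl
  rw [LinearMap.comp_apply, this, Finsupp.linearCombination_single, one_smul]

lemma cw_exists_pi {W : Type} [AddCommGroup W] [Module ℚ W] (φ : X → G → W) :
    ∃ f : (X → MonoidAlgebra ℚ G) →ₗ[ℚ] W,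
      ∀ x g, f (Pi.single x (MonoidAlgebra.of ℚ G g)) = φ x g := by
  choose f hf using fun x => cw_exists_alg (φ x)
  refine ⟨∑ x, f x ∘ₗ LinearMap.proj x, fun x g => ?_⟩
  rw [LinearMap.sum_apply, Finset.sum_eq_single x]
  · simp only [LinearMap.comp_apply, LinearMap.proj_apply, Pi.single_eq_same, hf]
  · intro b _ hb
    simp only [LinearMap.comp_apply, LinearMap.proj_apply, Pi.single_eq_of_ne hb, map_zero]
  · simp

/-- The relation module is the kernel of the boundary map. -/
lemma cw_relation (p : FreeGroup X →* G) (hp : Function.Surjective p)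
    (ι : K →* FreeGroup X) (hι : Function.Injective ι) (hK : ∀ w, p w = 1 ↔ ∃ k, ι k = w) :
    ∃ E : (ℚ ⊗[ℤ] Additive (Abelianization K)) ≃ₗ[ℚ] LinearMap.ker (cwBd p),
      ∀ k, (E (cwCl k) : X → MonoidAlgebra ℚ G) = cwD p (ι k) := by
  have hιp : ∀ k, p (ι k) = 1 := fun k => (hK _).2 ⟨k, rfl⟩
  obtain ⟨D, hD⟩ := cw_exists_lift (fun k => cwD p (ι k)) (by
    intro a b
    rw [map_mul, cwD_mul, hιp, map_one, one_smul])
  obtain ⟨s, hs, hs1⟩ : ∃ s : G → FreeGroup X, (∀ g, p (s g) = g) ∧ s 1 = 1 := by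
    classical
    choose s hs using hp
    refine ⟨Function.update s 1 1, fun g => ?_, by simp⟩
    by_cases h : g = 1
    · subst h; simp
    · simp [h, hs]
  have hκ : ∀ g w, ∃ k, ι k = s g * w * (s (g * p w))⁻¹ := fun g w => (hK _).1 (by simp [hs])
  choose κ hκ using hκ
  have κmul : ∀ g a b, κ g (a * b) = κ g a * κ (g * p a) b := by
    intro g a b
    apply hι
    rw [map_mul, hκ, hκ, hκ, map_mul]
    simp only [mul_assoc, inv_mul_cancel_left]
  obtain ⟨Ψ, hΨ⟩ := cw_exists_pi (X := X) (G := G) (fun x g => cwCl (κ g (FreeGroup.of x)))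
  have clone : cwCl (1 : K) = 0 := by
    have := cwCl_mul (1 : K) 1
    rw [mul_one] at this
    exact left_eq_add.1 this
  have κone : ∀ g, κ g 1 = 1 := fun g => hι (by rw [hκ]; simp)
  have hΨD : ∀ w g, Ψ (MonoidAlgebra.of ℚ G g • cwD p w) = cwCl (κ g w) := by
    intro w
    have hof : ∀ x g, Ψ (MonoidAlgebra.of ℚ G g • cwD p (FreeGroup.of x))
        = cwCl (κ g (FreeGroup.of x)) := by
      intro x g
      rw [cwD_of, ← Pi.single_smul, smul_eq_mul, mul_one, hΨ]
    induction w using FreeGroup.induction_on with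
    | C1 => intro g; rw [cwD_one, smul_zero, map_zero, κone, clone]
    | of x => exact hof x
    | inv_of x ih =>
      intro g
      have h1 := cwD_mul p (FreeGroup.of x)⁻¹ (FreeGroup.of x)
      rw [inv_mul_cancel, cwD_one] at h1
      have h2 := κmul g (FreeGroup.of x)⁻¹ (FreeGroup.of x)
      rw [inv_mul_cancel, κone] at h2
      have h3 := cwCl_mul (κ g (FreeGroup.of x)⁻¹) (κ (g * p (FreeGroup.of x)⁻¹) (FreeGroup.of x))
      rw [← h2, clone] at h3
      rw [eq_neg_of_add_eq_zero_left h1.symm, smul_neg, map_neg, smul_smul, ← map_mul, hof,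
        eq_neg_of_add_eq_zero_left h3.symm]
    | mul a b iha ihb =>
      intro g
      rw [cwD_mul, smul_add, map_add, smul_smul, ← map_mul, iha, ihb, κmul, cwCl_mul]
  have left : ∀ v, Ψ (D v) = v := by
    intro v
    have : Ψ ∘ₗ D = LinearMap.id := by
      apply cw_hom_ext
      intro k
      rw [LinearMap.comp_apply, hD, LinearMap.id_apply]
      have := hΨD (ι k) 1
      rw [map_one, one_smul] at this
      rw [this]
      congr 1
      apply hι
      rw [hκ, hιp, mul_one, hs1, inv_one, one_mul, mul_one]
    exact LinearMap.congr_fun this v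
  obtain ⟨L, hL⟩ := cw_exists_alg (G := G) (fun g => cwD p (s g))
  have right : ∀ z, D (Ψ z) = z - L (cwBd p z) := by
    intro z
    have : D ∘ₗ Ψ = LinearMap.id - L ∘ₗ (cwBd p).restrictScalars ℚ := by
      apply cw_pi_ext
      intro x g
      rw [LinearMap.comp_apply, hΨ, hD, hκ, cwD_mul_inv _ _ _ (by simp [hs]), cwD_mul, hs, cwD_of,
        LinearMap.sub_apply, LinearMap.comp_apply, LinearMap.restrictScalars_apply, cwBd_single,
        LinearMap.id_apply, mul_sub, mul_one, ← map_mul, map_sub, hL, hL, ← Pi.single_smul,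
        smul_eq_mul, mul_one]
      abel
    exact LinearMap.congr_fun this z
  have hmem : ∀ v, cwBd p (D v) = 0 := by
    intro v
    have : (cwBd p).restrictScalars ℚ ∘ₗ D = 0 := by
      apply cw_hom_ext
      intro k
      rw [LinearMap.comp_apply, hD, LinearMap.restrictScalars_apply, cwBd_D, hιp, map_one, sub_self,
        LinearMap.zero_apply]
    exact LinearMap.congr_fun this v
  refine ⟨{ toFun := fun v => ⟨D v, hmem v⟩
            map_add' := fun a b => Subtype.ext (map_add D a b)
            map_smul' := fun a b => Subtype.ext (map_smul D a b)
            invFun := fun z => Ψ z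
            left_inv := left
            right_inv := fun z => Subtype.ext ?_ }, hD⟩
  show D (Ψ z) = z
  rw [right, z.2, map_zero, sub_zero]

lemma cw_main {m : ℕ} [Finite G] (p : FreeGroup (Fin (m + 1)) →* G) (hp : Function.Surjective p)
    (ι : K →* FreeGroup (Fin (m + 1))) (hι : Function.Injective ι)
    (hK : ∀ w, p w = 1 ↔ ∃ k, ι k = w) :
    ∃ ρ : G →* ((ℚ ⊗[ℤ] Additive (Abelianization K)) ≃ₗ[ℚ] (ℚ ⊗[ℤ] Additive (Abelianization K))),
      (∀ w k k', ι k' = w * ι k * w⁻¹ → ρ (p w) (cwCl k) = cwCl k') ∧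
      Nonempty ((repOfAut ρ).asModule ≃ₗ[MonoidAlgebra ℚ G]
        ((Fin m → MonoidAlgebra ℚ G) ×
          (Representation.trivial ℚ (G := G) (V := ℚ)).asModule)) := by
  have hιp : ∀ k, p (ι k) = 1 := fun k => (hK _).2 ⟨k, rfl⟩
  obtain ⟨E, hE⟩ := cw_relation p hp ι hι hK
  let act : G → LinearMap.ker (cwBd p) ≃ₗ[ℚ] LinearMap.ker (cwBd p) := fun g =>
    { toFun := fun z => MonoidAlgebra.of ℚ G g • z
      map_add' := fun a b => smul_add _ a b
      map_smul' := fun c a => smul_comm _ c a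
      invFun := fun z => MonoidAlgebra.of ℚ G g⁻¹ • z
      left_inv := fun z => by
        beta_reduce
        rw [smul_smul, ← map_mul, inv_mul_cancel, map_one, one_smul]
      right_inv := fun z => by
        beta_reduce
        rw [smul_smul, ← map_mul, mul_inv_cancel, map_one, one_smul] }
  let ρ : G →* ((ℚ ⊗[ℤ] Additive (Abelianization K)) ≃ₗ[ℚ]
      (ℚ ⊗[ℤ] Additive (Abelianization K))) :=
    { toFun := fun g => E.trans ((act g).trans E.symm)
      map_one' := by
        apply LinearEquiv.ext
        intro v
        change E.symm (MonoidAlgebra.of ℚ G 1 • E v) = v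
        rw [map_one, one_smul, E.symm_apply_apply]
      map_mul' := fun g h => by
        apply LinearEquiv.ext
        intro v
        change E.symm (MonoidAlgebra.of ℚ G (g * h) • E v) =
          E.symm (MonoidAlgebra.of ℚ G g • E (E.symm (MonoidAlgebra.of ℚ G h • E v)))
        rw [E.apply_symm_apply, smul_smul, map_mul] }
  have hρ : ∀ g v, E (ρ g v) = MonoidAlgebra.of ℚ G g • E v := fun g v =>
    E.apply_symm_apply _
  refine ⟨ρ, ?_, ?_⟩
  · intro w k k' h
    apply E.injective
    rw [hρ]
    apply Subtype.ext
    rw [hE, h, Submodule.coe_smul, hE, cwD_mul_inv _ _ _ (by rw [map_mul, hιp, mul_one]), cwD_mul,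
      add_sub_cancel_left]
  · let ε : MonoidAlgebra ℚ G →ₗ[MonoidAlgebra ℚ G]
        (Representation.trivial ℚ (G := G) (V := ℚ)).asModule :=
      LinearMap.toSpanSingleton _ _ ((Representation.asModuleEquiv _).symm (1 : ℚ))
    have hεs : ∀ g c, ε (MonoidAlgebra.single g c) = (Representation.asModuleEquiv _).symm c := by
      intro g c
      rw [LinearMap.toSpanSingleton_apply, Representation.single_smul]
      apply (Representation.asModuleEquiv _).injective
      simp
      rfl
    have hε : Function.Surjective ε := fun c =>
      ⟨MonoidAlgebra.single 1 (Representation.asModuleEquiv _ c), by rw [hεs]; simp⟩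
    have hεof : ∀ g, ε (MonoidAlgebra.of ℚ G g) = ε 1 := by
      intro g
      rw [MonoidAlgebra.of_apply, hεs, MonoidAlgebra.one_def, hεs]
    have hr : LinearMap.range (cwBd p) = LinearMap.ker ε := by
      apply le_antisymm
      · rintro _ ⟨z, rfl⟩
        rw [LinearMap.mem_ker]
        have : ε ∘ₗ cwBd p = 0 := by
          apply LinearMap.pi_ext
          intro x r
          rw [LinearMap.comp_apply, cwBd_single, ← smul_eq_mul, map_smul, map_sub, hεof, sub_self,
            smul_zero, LinearMap.zero_apply]
        exact LinearMap.congr_fun this z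
      · intro r hr
        have key : ∀ r : MonoidAlgebra ℚ G, ∃ c : ℚ, r - c • 1 ∈ LinearMap.range (cwBd p) ∧
            ε r = (Representation.asModuleEquiv _).symm c := by
          intro r
          induction r using MonoidAlgebra.induction_on with
          | of a =>
            obtain ⟨w, rfl⟩ := hp a
            refine ⟨1, ⟨cwD p w, ?_⟩, ?_⟩
            · rw [cwBd_D, one_smul]
            · rw [MonoidAlgebra.of_apply, hεs]
          | add a b ha hb =>
            obtain ⟨c, h1, h2⟩ := ha
            obtain ⟨d, h3, h4⟩ := hb
            refine ⟨c + d, ?_, by rw [map_add, map_add, h2, h4]⟩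
            rw [add_smul, add_sub_add_comm]
            exact add_mem h1 h3
          | smul t a ha =>
            obtain ⟨c, h1, h2⟩ := ha
            refine ⟨t * c, ?_, ?_⟩
            · rw [mul_smul, ← smul_sub]
              exact Submodule.smul_of_tower_mem _ t h1
            · rw [LinearMap.map_smul_of_tower, h2, ← smul_eq_mul, map_smul]
        obtain ⟨c, h1, h2⟩ := key r
        rw [LinearMap.mem_ker.1 hr] at h2
        have : c = 0 := (Representation.asModuleEquiv _).symm.injective (by rw [← h2, map_zero])
        rw [this, zero_smul, sub_zero] at h1
        exact h1
    obtain ⟨F⟩ := cw_alg m (cwBd p) ε hε hr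
    let e₁ : (repOfAut ρ).asModule ≃ₗ[ℚ] LinearMap.ker (cwBd p) :=
      (Representation.asModuleEquiv _).trans E
    have he₁ : ∀ (r : MonoidAlgebra ℚ G) v, e₁ (r • v) = r • e₁ v := by
      intro r v
      induction r using MonoidAlgebra.induction_on with
      | of a =>
        rw [MonoidAlgebra.of_apply, Representation.single_smul, one_smul]
        exact hρ a (Representation.asModuleEquiv _ v)
      | add a b ha hb => rw [add_smul, add_smul, map_add, ha, hb]
      | smul t a ha => rw [smul_assoc, smul_assoc, map_smul, ha]
    let e₂ : (repOfAut ρ).asModule ≃ₗ[MonoidAlgebra ℚ G] LinearMap.ker (cwBd p) :=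
      { e₁ with map_smul' := he₁ }
    exact ⟨e₂.trans F⟩

end CW

/-- Observation 2.2 in Step 4 of the proof of Theorem 1.1 (Chevalley–Weil for the
subcover `Y₀`). Let `n ≥ 3`, `q : Fₙ → G` a surjection onto a finite group, `K = ker q`,
`A` the subgroup generated by all the generators except `a₀`, `K₀ = K ⊓ A`, and
`G₀ = q(A)`. Then conjugation induces a `G₀`-action on `V₀ = ℚ ⊗ K₀ᵃᵇ`, which as a
`ℚ[G₀]`-module is isomorphic to `ℚ[G₀]^{n-2} ⊕ ℚ`. -/
theorem chevalley_weil_for_subcover (n : ℕ) (hn : 3 ≤ n)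
    (G : Type) [Group G] [Finite G]
    (q : FreeGroup (Fin n) →* G) (hq : Function.Surjective q)
    (A : Subgroup (FreeGroup (Fin n)))
    (hA : A = Subgroup.closure (FreeGroup.of '' {i : Fin n | i ≠ ⟨0, by omega⟩})) :
    ∃ ρ₀ : ↥(Subgroup.map q A) →*
        ((ℚ ⊗[ℤ] Additive (Abelianization ↥(q.ker ⊓ A))) ≃ₗ[ℚ]
          (ℚ ⊗[ℤ] Additive (Abelianization ↥(q.ker ⊓ A)))),
      (∀ (w : A) (k : ↥(q.ker ⊓ A)),
        ρ₀ ⟨q w, Subgroup.mem_map_of_mem q w.2⟩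
            ((1 : ℚ) ⊗ₜ[ℤ] Additive.ofMul (Abelianization.of k)) =
          (1 : ℚ) ⊗ₜ[ℤ] Additive.ofMul (Abelianization.of
            (⟨(w : FreeGroup (Fin n)) * (k : FreeGroup (Fin n)) * (w : FreeGroup (Fin n))⁻¹,
              Subgroup.mem_inf.2
                ⟨(inferInstance : q.ker.Normal).conj_mem _ (Subgroup.mem_inf.1 k.2).1 _,
                 mul_mem (mul_mem w.2 (Subgroup.mem_inf.1 k.2).2) (inv_mem w.2)⟩⟩ :
              ↥(q.ker ⊓ A)))) ∧
      Nonempty ((repOfAut ρ₀).asModule ≃ₗ[MonoidAlgebra ℚ ↥(Subgroup.map q A)]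
        ((Fin (n - 2) → MonoidAlgebra ℚ ↥(Subgroup.map q A)) ×
          (Representation.trivial ℚ (G := ↥(Subgroup.map q A)) (V := ℚ)).asModule)) := by
  obtain ⟨m, rfl⟩ : ∃ m, n = m + 2 := ⟨n - 2, by omega⟩
  let j : FreeGroup (Fin (m + 1)) →* FreeGroup (Fin (m + 2)) := FreeGroup.map Fin.succ
  have hj : Function.Injective j := FreeGroup.map_injective (Fin.succ_injective _)
  have hjA : j.range = A := by
    rw [hA, MonoidHom.range_eq_map, ← FreeGroup.closure_range_of, MonoidHom.map_closure,
      ← Set.range_comp]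
    congr 1
    ext w
    constructor
    · rintro ⟨i, rfl⟩
      exact ⟨i.succ, Fin.succ_ne_zero i, by simp [j]⟩
    · rintro ⟨i, hi, rfl⟩
      obtain ⟨i', rfl⟩ := Fin.exists_succ_eq.2 hi
      exact ⟨i', by simp [j]⟩
  let e : FreeGroup (Fin (m + 1)) ≃* A :=
    (MonoidHom.ofInjective hj).trans (MulEquiv.subgroupCongr hjA)
  have he : ∀ w, ((e w : A) : FreeGroup (Fin (m + 2))) = j w := fun _ => rfl
  let p : FreeGroup (Fin (m + 1)) →* ↥(Subgroup.map q A) := (q.subgroupMap A).comp e.toMonoidHom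
  have hpv : ∀ w, ((p w : ↥(Subgroup.map q A)) : G) = q (e w : A) := fun _ => rfl
  have hp : Function.Surjective p := (q.subgroupMap_surjective A).comp e.surjective
  let ι : ↥(q.ker ⊓ A) →* FreeGroup (Fin (m + 1)) :=
    e.symm.toMonoidHom.comp (Subgroup.inclusion inf_le_right)
  have hιv : ∀ k, ((e (ι k) : A) : FreeGroup (Fin (m + 2))) = k := by
    intro k
    change ((e (e.symm (Subgroup.inclusion inf_le_right k)) : A) : FreeGroup (Fin (m + 2))) = k
    rw [e.apply_symm_apply]; rfl
  have hι : Function.Injective ι := e.symm.injective.comp (Subgroup.inclusion_injective _)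
  have hK : ∀ w, p w = 1 ↔ ∃ k, ι k = w := by
    intro w
    constructor
    · intro h
      have h' : q (e w : A) = 1 := by rw [← hpv, h]; rfl
      refine ⟨⟨(e w : A), Subgroup.mem_inf.2 ⟨h', (e w).2⟩⟩, ?_⟩
      apply e.injective
      apply Subtype.ext
      rw [hιv]
    · rintro ⟨k, rfl⟩
      apply Subtype.ext
      rw [hpv, hιv]
      exact (Subgroup.mem_inf.1 k.2).1
  obtain ⟨ρ, h1, h2⟩ := cw_main p hp ι hι hK
  refine ⟨ρ, ?_, h2⟩
  intro w k
  have hw : (⟨q w, Subgroup.mem_map_of_mem q w.2⟩ : ↥(Subgroup.map q A)) = p (e.symm w) := by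
    apply Subtype.ext
    rw [hpv, e.apply_symm_apply]
  rw [hw]
  apply h1 (e.symm w) k
  apply e.injective
  apply Subtype.ext
  rw [hιv, map_mul, map_mul, map_inv, e.apply_symm_apply]
  simp [hιv]
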